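/- Let p be a prime and w a word over {0,...,p-1} with |w| > 1 and w ≠ 10 (the two-letter word with digits 1 then 0). Then the sequence (a_{p;w}(n))_{n≥0} is not a fixed point of any non-erasing morphism φ: {0,...,p-1}* → {0,...,p-1}* with φ prolongable on its first letter; i.e., it is not purely morphic. -/

import Mathlib

/-- Number of occurrences of the word `w` as a factor of the word `x`. -/
def occCount (w x : List ℕ) : ℕ :=
  (List.range (x.length + 1)).countP (fun i => decide (w <+: x.drop i))

/-- Base-`m` expansion of `n`, most significant digit first, with `0` written as the digit `0`. -/
def baseExp (m n : ℕ) : List ℕ :=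
  if n = 0 then [0] else (Nat.digits m n).reverse

/-- `e_{m;w}(n)`: number of occurrences of `w` in the base-`m` expansion of `n`. -/
def eCount (m : ℕ) (w : List ℕ) (n : ℕ) : ℕ := occCount w (baseExp m n)

/-- `a_{m;w}(n) = e_{m;w}(n) mod m`. -/
def aSeq (m : ℕ) (w : List ℕ) (n : ℕ) : ℕ := eCount m w n % m

/-- The value `(w)_m` of the digit string `w` in base `m`. -/
def wordVal (m : ℕ) (w : List ℕ) : ℕ := w.foldl (fun acc d => acc * m + d) 0

/-- The finite word `v` is a prefix of the infinite sequence `s`. -/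
def IsPrefixSeq (v : List ℕ) (s : ℕ → ℕ) : Prop := ∀ n < v.length, s n = v.getD n 0

/-- Length of the image under the morphism `φ` of the first `n` letters of `s`. -/
def morphPrefixLen (φ : ℕ → List ℕ) (s : ℕ → ℕ) (n : ℕ) : ℕ :=
  (Finset.range n).sum fun j => (φ (s j)).length

/-- The infinite sequence `s` is a fixed point of the morphism `φ` (extended by
concatenation to infinite words). -/
def IsMorphFixedPoint (φ : ℕ → List ℕ) (s : ℕ → ℕ) : Prop :=
  ∀ n : ℕ, ∀ i < (φ (s n)).length,
    s (morphPrefixLen φ s n + i) = (φ (s n)).getD i 0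

/-- The sequence `s` over the alphabet `{0,...,p-1}` is purely morphic: it is a fixed
point of a non-erasing morphism of `{0,...,p-1}*`, prolongable on the first letter. -/
def PurelyMorphic (p : ℕ) (s : ℕ → ℕ) : Prop :=
  ∃ φ : ℕ → List ℕ,
    (∀ c < p, φ c ≠ [] ∧ ∀ d ∈ φ c, d < p) ∧
    2 ≤ (φ (s 0)).length ∧
    IsMorphFixedPoint φ s

theorem occCount_cons (w : List ℕ) (b : ℕ) (x : List ℕ) :
    occCount w (b :: x) = occCount w x + if w <+: b :: x then 1 else 0 := by
  simp [occCount, List.range_succ_eq_map (n := x.length + 1), List.countP_cons, List.countP_map,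
    Function.comp_def]

theorem occCount_concat {w : List ℕ} (hw : w ≠ []) (x : List ℕ) (a : ℕ) :
    occCount w (x ++ [a]) = occCount w x + if w <:+ x ++ [a] then 1 else 0 := by
  induction x with
  | nil =>
    rw [List.nil_append, occCount_cons]
    congr 1
    have : w <+: [a] ↔ w <:+ [a] := by
      rw [List.prefix_cons_iff, List.suffix_cons_iff]
      simp [hw]
    simp only [this]
  | cons b x ih =>
    rw [List.cons_append, occCount_cons, occCount_cons, ih]
    have h1 : w <+: b :: (x ++ [a]) ↔ w = b :: (x ++ [a]) ∨ w <+: b :: x := by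
      rw [← List.cons_append, List.prefix_concat_iff]
    have h2 : w <:+ b :: (x ++ [a]) ↔ w = b :: (x ++ [a]) ∨ w <:+ x ++ [a] :=
      List.suffix_cons_iff
    by_cases h : w = b :: (x ++ [a])
    · have h3 : ¬ w <+: b :: x := fun h' => by
        have := h'.length_le
        simp [h] at this
      have h4 : ¬ w <:+ x ++ [a] := fun h' => by
        have := h'.length_le
        simp [h] at this
      rw [if_neg h4, if_neg h3, if_pos (h1.2 (Or.inl h)), if_pos (h2.2 (Or.inl h))]
    · simp only [h1, h2, h, false_or]
      omega

theorem occCount_eq_zero_of_length_lt {w x : List ℕ} (h : x.length < w.length) :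
    occCount w x = 0 := by
  rw [occCount, List.countP_eq_zero]
  intro i _
  rw [decide_eq_true_eq]
  intro h'
  have := h'.length_le
  simp only [List.length_drop] at this
  omega

theorem baseExp_mul_add {p : ℕ} (hp : 1 < p) {n i : ℕ} (hn : n ≠ 0) (hi : i < p) :
    baseExp p (p * n + i) = baseExp p n ++ [i] := by
  have h : p * n + i ≠ 0 := by
    have : 0 < p * n := by positivity
    omega
  rw [baseExp, baseExp, if_neg h, if_neg hn, add_comm,
    Nat.digits_add p hp i n hi (Or.inr hn), List.reverse_cons]

theorem baseExp_of_lt {p n : ℕ} (hn : n < p) : baseExp p n = [n] := by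
  rw [baseExp]
  split_ifs with h
  · rw [h]
  · rw [Nat.digits_of_lt p n h hn, List.reverse_singleton]

theorem exists_baseExp_eq_one_cons {p : ℕ} (hp : 1 < p) (w : List ℕ) (hw : ∀ d ∈ w, d < p) :
    ∃ n, n ≠ 0 ∧ baseExp p n = 1 :: w := by
  induction w using List.reverseRecOn with
  | nil => exact ⟨1, one_ne_zero, baseExp_of_lt hp⟩
  | append_singleton w d ih =>
    obtain ⟨n, hn, h⟩ := ih fun c hc => hw c (by simp [hc])
    refine ⟨p * n + d, ?_, ?_⟩
    · have : 0 < p * n := by positivity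
      omega
    · rw [baseExp_mul_add hp hn (hw d (by simp)), h, List.cons_append]

theorem aSeq_of_lt {p n : ℕ} {w : List ℕ} (hlen : 1 < w.length) (hn : n < p) :
    aSeq p w n = 0 := by
  rw [aSeq, eCount, baseExp_of_lt hn, occCount_eq_zero_of_length_lt (by simpa using hlen),
    Nat.zero_mod]

theorem eCount_mul_add {p : ℕ} (hp : 1 < p) {w : List ℕ} (hw : w ≠ []) {n i : ℕ} (hn : n ≠ 0)
    (hi : i < p) :
    eCount p w (p * n + i) = eCount p w n + if w <:+ baseExp p n ++ [i] then 1 else 0 := by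
  rw [eCount, baseExp_mul_add hp hn hi, occCount_concat hw, eCount]

theorem suffix_of_aSeq_mul_add_ne {p : ℕ} (hp : 1 < p) {w : List ℕ} (hlen : 1 < w.length)
    {n i : ℕ} (hi : i < p) (h : aSeq p w (p * n + i) ≠ aSeq p w n) :
    n ≠ 0 ∧ w <:+ baseExp p n ++ [i] := by
  have hw : w ≠ [] := by
    rintro rfl
    simp at hlen
  by_cases hn : n = 0
  · subst hn
    rw [mul_zero, zero_add, aSeq_of_lt hlen hi, aSeq_of_lt hlen (by omega)] at h
    exact absurd rfl h
  · refine ⟨hn, ?_⟩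
    by_contra hs
    rw [aSeq, eCount_mul_add hp hw hn hi, if_neg hs] at h
    exact h rfl

theorem digits_of_aSeq_mul_add_ne {p : ℕ} (hp : 1 < p) {u : List ℕ} {b d n i : ℕ} (hi : i < p)
    (h : aSeq p (u ++ [b, d]) (p * n + i) ≠ aSeq p (u ++ [b, d]) n) :
    i = d ∧ n % p = b := by
  obtain ⟨hn, t, ht⟩ := suffix_of_aSeq_mul_add_ne hp (by simp) hi h
  have ht' : (t ++ u ++ [b]) ++ [d] = baseExp p n ++ [i] := by simpa using ht
  obtain ⟨h1, h2⟩ := List.append_inj' ht' rfl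
  refine ⟨by simpa using h2.symm, ?_⟩
  have h3 : n = p * (n / p) + n % p := (Nat.div_add_mod n p).symm
  have hlt : n % p < p := Nat.mod_lt _ (by omega)
  by_cases hq : n / p = 0
  · rw [hq, mul_zero, zero_add] at h3
    rw [baseExp_of_lt (h3 ▸ hlt)] at h1
    have h4 : (t ++ u) ++ [b] = [] ++ [n] := h1
    have : b = n := by simpa using (List.append_inj' h4 rfl).2
    omega
  · rw [h3, baseExp_mul_add hp hq hlt] at h1
    have h4 := List.append_inj' h1 rfl
    simpa using h4.2.symm

theorem exists_aSeq_ne_zero {p : ℕ} (hp : 1 < p) {w : List ℕ} (hw : ∀ d ∈ w, d < p)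
    (hne : w ≠ []) : ∃ n, aSeq p w n ≠ 0 := by
  obtain ⟨u, d, rfl⟩ := List.eq_nil_or_concat' w |>.resolve_left hne
  obtain ⟨n, hn, h⟩ := exists_baseExp_eq_one_cons hp u fun c hc => hw c (by simp [hc])
  by_contra! hzero
  have h1 := hzero n
  have h2 := hzero (p * n + d)
  rw [aSeq] at h1 h2
  rw [eCount_mul_add hp hne hn (hw d (by simp)), h, if_pos ⟨[1], by simp⟩] at h2
  have h3 := (Nat.dvd_add_right (Nat.dvd_of_mod_eq_zero h1)).1 (Nat.dvd_of_mod_eq_zero h2)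
  have := Nat.le_of_dvd one_pos h3
  omega

/-- A sequence whose value at `p * n + i` can differ from its value at `n` only when `i = d` and
`n % p = b` has no prefix that is a `(p + 1)`-st power of a word that is not a block of zeros. -/
theorem not_prefix_power {p b d N : ℕ} (hp : 1 < p) {s : ℕ → ℕ}
    (hs : ∀ n, ∀ i < p, s (p * n + i) ≠ s n → i = d ∧ n % p = b)
    (hzero : ∀ n < N, s n = 0) (hN : s N ≠ 0) (hpN : p < N) (L : ℕ) (hL : N < L) :
    ¬ ∀ j ≤ p, ∀ i < L, s (j * L + i) = s i := by
  induction L using Nat.strong_induction_on with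
  | _ L ih =>
    intro hper
    have hNdm : p * (N / p) + N % p = N := Nat.div_add_mod N p
    have hlt : N % p < p := Nat.mod_lt _ (by omega)
    have hn : N / p < N := Nat.div_lt_self (by omega) hp
    have h1 : (N / p) % p = b := by
      refine (hs (N / p) (N % p) hlt ?_).2
      rw [hNdm, hzero _ hn]
      exact hN
    have h2 : (L + N / p) % p = b := by
      refine (hs (L + N / p) (N % p) hlt ?_).2
      have e1 : p * (L + N / p) + N % p = p * L + N := by
        rw [mul_add, add_assoc, hNdm]
      have e2 := hper 1 hp.le (N / p) (by omega)
      rw [one_mul] at e2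
      rw [e1, hper p le_rfl N hL, e2, hzero _ hn]
      exact hN
    have hdvd : p ∣ L := by
      have h3 : L + N / p ≡ 0 + N / p [MOD p] := by
        rw [zero_add]
        exact h2.trans h1.symm
      exact (Nat.modEq_zero_iff_dvd).1 (Nat.ModEq.add_right_cancel' _ h3)
    obtain ⟨K, rfl⟩ := hdvd
    obtain ⟨c, hc, hcd⟩ : ∃ c < p, c ≠ d := by
      by_cases h : d = 0
      · exact ⟨1, hp, by omega⟩
      · exact ⟨0, by omega, by omega⟩
    have hsc : ∀ n, s (p * n + c) = s n := fun n => by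
      by_contra h
      exact hcd (hs n c hc h).1
    have hK : ∀ j ≤ p, ∀ i < K, s (j * K + i) = s i := by
      intro j hj i hi
      have hi' : p * i + c < p * K := by
        have := Nat.mul_le_mul_left p (Nat.succ_le_of_lt hi)
        rw [Nat.mul_succ] at this
        omega
      have e := hper j hj (p * i + c) hi'
      rw [← hsc (j * K + i), ← hsc i, ← e]
      congr 1
      ring
    have hKpos : 0 < K := Nat.pos_of_ne_zero fun h => by simp [h] at hL
    by_cases hKN : N < K
    · exact ih K (by nlinarith) hKN hK
    · have hq : N / K < p := (Nat.div_lt_iff_lt_mul hKpos).2 hL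
      have hr : N % K < K := Nat.mod_lt _ hKpos
      have e := hK (N / K) hq.le (N % K) hr
      rw [mul_comm, Nat.div_add_mod, hzero (N % K) (by omega)] at e
      exact hN e

theorem IsMorphFixedPoint.power_prefix {φ : ℕ → List ℕ} {s : ℕ → ℕ} {N : ℕ}
    (h : IsMorphFixedPoint φ s) (hzero : ∀ n < N, s n = 0) {j : ℕ} (hj : j < N) {i : ℕ}
    (hi : i < (φ 0).length) : s (j * (φ 0).length + i) = s i := by
  have hlen : ∀ k < N, morphPrefixLen φ s k = k * (φ 0).length := by
    intro k hk
    rw [morphPrefixLen, Finset.sum_congr rfl fun n hn => by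
      rw [hzero n ((Finset.mem_range.1 hn).trans hk)]]
    simp
  have key : ∀ k < N, s (k * (φ 0).length + i) = (φ 0).getD i 0 := by
    intro k hk
    have := h k i (by rwa [hzero k hk])
    rwa [hlen k hk, hzero k hk] at this
  have e := key 0 (by omega)
  rw [zero_mul, zero_add] at e
  rw [key j hj, e]

theorem stmt12 (p : ℕ) (hp : p.Prime) (w : List ℕ)
    (hw : ∀ d ∈ w, d < p) (hlen : 1 < w.length) (hne : w ≠ [1, 0]) :
    ¬ PurelyMorphic p (aSeq p w) := by
  rintro ⟨φ, -, hφ, hfix⟩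
  have hp1 := hp.one_lt
  have hwnil : w ≠ [] := by
    rintro rfl
    simp at hlen
  have hex := exists_aSeq_ne_zero hp1 hw hwnil
  obtain ⟨N, hN, hzero⟩ : ∃ N, aSeq p w N ≠ 0 ∧ ∀ n < N, aSeq p w n = 0 :=
    ⟨Nat.find hex, Nat.find_spec hex, fun n hn => not_not.1 (Nat.find_min hex hn)⟩
  have hpN : p < N := by
    by_contra! hle
    apply hN
    rcases hle.lt_or_eq with hlt | rfl
    · exact aSeq_of_lt hlen hlt
    · by_contra h
      have h0 : aSeq N w 1 = 0 := aSeq_of_lt hlen hp1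
      have hsuf := (suffix_of_aSeq_mul_add_ne (n := 1) (i := 0) hp1 hlen hp.pos
        (by simpa [h0] using h)).2
      rw [baseExp_of_lt hp1] at hsuf
      exact hne (hsuf.eq_of_length_le hlen)
  rw [aSeq_of_lt hlen hp.pos] at hφ
  have hL : N < (φ 0).length := by
    by_contra! hle
    have hr : N % (φ 0).length < (φ 0).length := Nat.mod_lt _ (by omega)
    have e := hfix.power_prefix hzero (j := N / (φ 0).length)
      (Nat.div_lt_self (by omega) hφ) hr
    rw [mul_comm, Nat.div_add_mod, hzero (N % (φ 0).length) (by omega)] at e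
    exact hN e
  obtain ⟨v, d, rfl⟩ := List.eq_nil_or_concat' w |>.resolve_left hwnil
  have hv : v ≠ [] := by
    rintro rfl
    simp at hlen
  obtain ⟨u, b, rfl⟩ := List.eq_nil_or_concat' v |>.resolve_left hv
  rw [List.append_assoc, List.singleton_append] at *
  exact not_prefix_power hp1 (fun n i hi h => digits_of_aSeq_mul_add_ne hp1 hi h) hzero hN hpN _ hL
    fun j hj i hi => hfix.power_prefix hzero (by omega) hi
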